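/- arXiv:2605.01254 — 7 statements merged into one kernel-verified Lean document; each statement's English description precedes it below -/
import Mathlib

section
/- Let α ∈ (0,1), δ ∈ (0,1), and let Ω = (0,1)×(0,1) ⊂ ℝ² with coordinates z = (θ,r). Then for every smooth compactly supported function u : Ω → ℝ one has ∫_{(0,1)×(0,δ)} u(θ,r)² dθ dr ≤ (4/(1-α)²) δ^{2-α} ∫_Ω r^α (∂_r u(θ,r))² dθ dr. -/
open MeasureTheory Set

/-- Radial partial derivative ∂_r u at z = (θ, r). -/
noncomputable def pr (u : ℝ × ℝ → ℝ) (z : ℝ × ℝ) : ℝ := deriv (fun r => u (z.1, r)) z.2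

/-- Weighted one-dimensional Cauchy-Schwarz bound for a function vanishing at the origin. -/
theorem sq_le_rpow_mul_integral_rpow_mul_deriv_sq {α r : ℝ} (hα : α ∈ Ioo (0 : ℝ) 1) (hr : 0 < r)
    {g : ℝ → ℝ} (hg : ContDiff ℝ 1 g) (hg0 : g 0 = 0) :
    g r ^ 2 ≤ r ^ (1 - α) / (1 - α) * ∫ s in (0 : ℝ)..r, s ^ α * deriv g s ^ 2 := by
  have hα1 : 0 < 1 - α := by linarith [hα.2]
  have hdc : Continuous (deriv g) := hg.continuous_deriv le_rfl
  have hrc : Continuous fun s : ℝ => s ^ α := Real.continuous_rpow_const hα.1.le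
  have hftc : ∫ s in (0 : ℝ)..r, deriv g s = g r := by
    rw [intervalIntegral.integral_deriv_eq_sub
      (fun x _ => hg.differentiable one_ne_zero x) (hdc.intervalIntegrable _ _), hg0, sub_zero]
  have hK : ∫ s in (0 : ℝ)..r, s ^ (-α) = r ^ (1 - α) / (1 - α) := by
    rw [integral_rpow (Or.inl (by linarith)), neg_add_eq_sub, Real.zero_rpow hα1.ne', sub_zero]
  set K := r ^ (1 - α) / (1 - α)
  set A := ∫ s in (0 : ℝ)..r, s ^ α * deriv g s ^ 2 with hA
  have hKpos : 0 < K := div_pos (Real.rpow_pos_of_pos hr _) hα1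
  have hi1 : IntervalIntegrable (fun s => s ^ α * deriv g s ^ 2) volume 0 r :=
    (hrc.mul (hdc.pow 2)).intervalIntegrable _ _
  have hi3 : IntervalIntegrable (fun s : ℝ => s ^ (-α)) volume 0 r :=
    intervalIntegral.intervalIntegrable_rpow' (by linarith [hα.2])
  have key (c : ℝ) : 0 ≤ A - 2 * c * g r + c ^ 2 * K := by
    have hi2 : IntervalIntegrable (fun s => 2 * c * deriv g s) volume 0 r :=
      (continuous_const.mul hdc).intervalIntegrable _ _
    rw [← hftc, ← hK, hA, ← intervalIntegral.integral_const_mul,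
      ← intervalIntegral.integral_const_mul, ← intervalIntegral.integral_sub hi1 hi2,
      ← intervalIntegral.integral_add (hi1.sub hi2) (hi3.const_mul _)]
    refine intervalIntegral.integral_nonneg_of_ae_restrict hr.le ?_
    rw [← restrict_Ioc_eq_restrict_Icc]
    filter_upwards [ae_restrict_mem measurableSet_Ioc] with s hs
    have hpos : 0 < s ^ α := Real.rpow_pos_of_pos hs.1 _
    have hsq : s ^ α * deriv g s ^ 2 - 2 * c * deriv g s + c ^ 2 * s ^ (-α)
        = s ^ α * (deriv g s - c * s ^ (-α)) ^ 2 := by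
      rw [Real.rpow_neg hs.1.le]
      field_simp
      ring
    simp only [Pi.zero_apply, hsq]
    positivity
  have h := key (g r / K)
  have h' : A - 2 * (g r / K) * g r + (g r / K) ^ 2 * K = A - g r ^ 2 / K := by
    field_simp
    ring
  rw [h', sub_nonneg, div_le_iff₀ hKpos] at h
  linarith

theorem continuous_pr {u : ℝ × ℝ → ℝ} (hu : ContDiff ℝ 1 u) : Continuous (pr u) := by
  have h : pr u = fun z => fderiv ℝ u z (0, 1) := by
    ext z
    have hd : HasDerivAt (fun r : ℝ => (z.1, r)) (0, 1) z.2 :=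
      (hasDerivAt_const _ _).prodMk (hasDerivAt_id _)
    exact ((hu.differentiable one_ne_zero z).hasFDerivAt.comp_hasDerivAt z.2 hd).deriv
  rw [h]
  exact (hu.continuous_fderiv one_ne_zero).clm_apply continuous_const

theorem Continuous.integrableOn_Ioo_prod_Ioo {f : ℝ × ℝ → ℝ} (hf : Continuous f) (a b c d : ℝ) :
    IntegrableOn f (Ioo a b ×ˢ Ioo c d) :=
  (hf.continuousOn.integrableOn_compact (isCompact_Icc.prod isCompact_Icc)).mono_set
    (prod_mono Ioo_subset_Icc_self Ioo_subset_Icc_self)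

/-- Near-boundary truncation on a single radial slice. -/
theorem integral_sq_le_rpow_mul_integral_rpow_mul_deriv_sq {α δ : ℝ} (hα : α ∈ Ioo (0 : ℝ) 1)
    (hδ : δ ∈ Ioo (0 : ℝ) 1) {g : ℝ → ℝ} (hg : ContDiff ℝ 1 g) (hg0 : g 0 = 0) :
    ∫ r in Ioo (0 : ℝ) δ, g r ^ 2
      ≤ 4 / (1 - α) ^ 2 * δ ^ (2 - α) * ∫ r in Ioo (0 : ℝ) 1, r ^ α * deriv g r ^ 2 := by
  have hα1 : 0 < 1 - α := by linarith [hα.2]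
  have hcont : Continuous fun s : ℝ => s ^ α * deriv g s ^ 2 :=
    (Real.continuous_rpow_const hα.1.le).mul ((hg.continuous_deriv le_rfl).pow 2)
  set A := ∫ r in Ioo (0 : ℝ) 1, r ^ α * deriv g r ^ 2 with hA
  have hA0 : 0 ≤ A := setIntegral_nonneg measurableSet_Ioo fun s hs =>
    mul_nonneg (Real.rpow_nonneg hs.1.le _) (sq_nonneg _)
  have hpt : ∀ r ∈ Ioo (0 : ℝ) δ, g r ^ 2 ≤ δ ^ (1 - α) / (1 - α) * A := by
    intro r hr
    refine (sq_le_rpow_mul_integral_rpow_mul_deriv_sq hα hr.1 hg hg0).trans ?_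
    have hle : ∫ s in (0 : ℝ)..r, s ^ α * deriv g s ^ 2 ≤ A := by
      rw [hA, ← integral_Ioc_eq_integral_Ioo, ← intervalIntegral.integral_of_le zero_le_one]
      refine intervalIntegral.integral_mono_interval le_rfl hr.1.le (hr.2.trans hδ.2).le ?_
        (hcont.intervalIntegrable _ _)
      filter_upwards [ae_restrict_mem measurableSet_Ioc] with s hs
      exact mul_nonneg (Real.rpow_nonneg hs.1.le _) (sq_nonneg _)
    have hpow : r ^ (1 - α) ≤ δ ^ (1 - α) := Real.rpow_le_rpow hr.1.le hr.2.le hα1.le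
    have hδ0 : 0 ≤ δ ^ (1 - α) := Real.rpow_nonneg hδ.1.le _
    have hr0 : 0 ≤ r ^ (1 - α) := Real.rpow_nonneg hr.1.le _
    calc _ ≤ r ^ (1 - α) / (1 - α) * A := by gcongr
      _ ≤ _ := by gcongr
  have hint : IntegrableOn (fun r => g r ^ 2) (Ioo 0 δ) :=
    ((hg.continuous.pow 2).integrableOn_Icc).mono_set Ioo_subset_Icc_self
  have hδpow : δ ^ (2 - α) = δ * δ ^ (1 - α) := by
    rw [← Real.rpow_one_add' hδ.1.le (by linarith)]
    ring_nf
  have hδ0 : 0 ≤ δ ^ (2 - α) := Real.rpow_nonneg hδ.1.le _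
  have hconst : 1 / (1 - α) ≤ 4 / (1 - α) ^ 2 := by
    rw [div_le_div_iff₀ hα1 (by positivity)]
    nlinarith [hα.1]
  calc ∫ r in Ioo (0 : ℝ) δ, g r ^ 2
      ≤ ∫ _ in Ioo (0 : ℝ) δ, δ ^ (1 - α) / (1 - α) * A :=
        setIntegral_mono_on hint (integrableOn_const (by simp)) measurableSet_Ioo hpt
    _ = 1 / (1 - α) * δ ^ (2 - α) * A := by
        rw [setIntegral_const, Real.volume_real_Ioo_of_le hδ.1.le, smul_eq_mul, hδpow]
        ring
    _ ≤ _ := by gcongr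

/-- Near-boundary truncation estimate: for α ∈ (0,1), δ ∈ (0,1),
and u ∈ C_c^∞((0,1)×(0,1)),
∫_{(0,1)×(0,δ)} u² ≤ (4/(1-α)²) δ^{2-α} ∫_Ω r^α (∂_r u)². -/
theorem near_boundary_truncation (α δ : ℝ) (hα : α ∈ Ioo (0:ℝ) 1) (hδ : δ ∈ Ioo (0:ℝ) 1)
    (u : ℝ × ℝ → ℝ) (hu : ContDiff ℝ (⊤ : ℕ∞) u) (hcs : HasCompactSupport u)
    (hsupp : tsupport u ⊆ Ioo (0:ℝ) 1 ×ˢ Ioo (0:ℝ) 1) :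
    ∫ z in Ioo (0:ℝ) 1 ×ˢ Ioo (0:ℝ) δ, (u z) ^ 2
      ≤ (4 / (1 - α) ^ 2) * δ ^ (2 - α) *
        ∫ z in Ioo (0:ℝ) 1 ×ˢ Ioo (0:ℝ) 1, z.2 ^ α * (pr u z) ^ 2 := by
  have hu1 : ContDiff ℝ 1 u := hu.of_le (by exact_mod_cast le_top)
  have hi1 : IntegrableOn (fun z => u z ^ 2) (Ioo 0 1 ×ˢ Ioo 0 δ) :=
    Continuous.integrableOn_Ioo_prod_Ioo (hu1.continuous.pow 2) 0 1 0 δ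
  have hi2 : IntegrableOn (fun z => z.2 ^ α * pr u z ^ 2) (Ioo 0 1 ×ˢ Ioo 0 1) :=
    Continuous.integrableOn_Ioo_prod_Ioo
      (((Real.continuous_rpow_const hα.1.le).comp continuous_snd).mul ((continuous_pr hu1).pow 2))
      0 1 0 1
  rw [Measure.volume_eq_prod] at hi1 hi2 ⊢
  rw [setIntegral_prod _ hi1, setIntegral_prod _ hi2, ← integral_const_mul]
  rw [IntegrableOn, ← Measure.prod_restrict] at hi1 hi2
  refine integral_mono hi1.integral_prod_left (hi2.integral_prod_left.const_mul _) fun θ => ?_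
  refine integral_sq_le_rpow_mul_integral_rpow_mul_deriv_sq hα hδ (g := fun r => u (θ, r))
    (hu1.comp (contDiff_const.prodMk contDiff_id)) ?_
  exact image_eq_zero_of_notMem_tsupport fun h => lt_irrefl _ (hsupp h).2.1
end

section
/- Let α ∈ (0,1) and let Ω = (0,1)×(0,1) ⊂ ℝ² with coordinates z = (θ,r). Then for every smooth compactly supported function u : Ω → ℝ one has the exact identity ∫_Ω (∂_{θθ}u + ∂_r(r^α ∂_r u))² dθ dr = ∫_Ω (∂_{θθ}u)² dθ dr + ∫_Ω (∂_r(r^α ∂_r u))² dθ dr + 2 ∫_Ω r^α (∂_{θ r}u)² dθ dr. -/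
open MeasureTheory Set

/-- Angular partial derivative ∂_θ u at z = (θ, r). -/
noncomputable def pth (u : ℝ × ℝ → ℝ) (z : ℝ × ℝ) : ℝ := deriv (fun θ => u (θ, z.2)) z.1

open scoped ContDiff

theorem pth_eq_fderiv {u : ℝ × ℝ → ℝ} (hu : Differentiable ℝ u) :
    pth u = fun z => fderiv ℝ u z (1, 0) := by
  funext z
  have h : HasDerivAt (fun θ : ℝ => (θ, z.2)) ((1 : ℝ), (0 : ℝ)) z.1 :=
    (hasDerivAt_id z.1).prodMk (hasDerivAt_const z.1 z.2)
  exact ((hu z).hasFDerivAt.comp_hasDerivAt (x := z.1) (f := fun θ : ℝ => (θ, z.2)) h).deriv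

theorem pr_eq_fderiv {u : ℝ × ℝ → ℝ} (hu : Differentiable ℝ u) :
    pr u = fun z => fderiv ℝ u z (0, 1) := by
  funext z
  have h : HasDerivAt (fun r : ℝ => (z.1, r)) ((0 : ℝ), (1 : ℝ)) z.2 :=
    (hasDerivAt_const z.2 z.1).prodMk (hasDerivAt_id z.2)
  exact ((hu z).hasFDerivAt.comp_hasDerivAt (x := z.2) (f := fun r : ℝ => (z.1, r)) h).deriv

theorem contDiff_fderiv_const {u : ℝ × ℝ → ℝ} (hu : ContDiff ℝ ∞ u) (v : ℝ × ℝ) :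
    ContDiff ℝ ∞ (fun z => fderiv ℝ u z v) :=
  (hu.fderiv_right (m := ∞) (by simp)).clm_apply contDiff_const

theorem contDiff_pth {u : ℝ × ℝ → ℝ} (hu : ContDiff ℝ ∞ u) : ContDiff ℝ ∞ (pth u) := by
  rw [pth_eq_fderiv (hu.differentiable (by simp))]
  exact contDiff_fderiv_const hu _

theorem contDiff_pr {u : ℝ × ℝ → ℝ} (hu : ContDiff ℝ ∞ u) : ContDiff ℝ ∞ (pr u) := by
  rw [pr_eq_fderiv (hu.differentiable (by simp))]
  exact contDiff_fderiv_const hu _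

theorem tsupport_pth_subset {u : ℝ × ℝ → ℝ} (hu : Differentiable ℝ u) :
    tsupport (pth u) ⊆ tsupport u := by
  rw [pth_eq_fderiv hu]
  exact tsupport_fderiv_apply_subset ℝ _

theorem tsupport_pr_subset {u : ℝ × ℝ → ℝ} (hu : Differentiable ℝ u) :
    tsupport (pr u) ⊆ tsupport u := by
  rw [pr_eq_fderiv hu]
  exact tsupport_fderiv_apply_subset ℝ _

theorem pth_pr_comm {u : ℝ × ℝ → ℝ} (hu : ContDiff ℝ ∞ u) : pth (pr u) = pr (pth u) := by
  have hd : Differentiable ℝ u := hu.differentiable (by simp)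
  have hd' : Differentiable ℝ (fderiv ℝ u) :=
    (hu.fderiv_right (m := ∞) (by simp)).differentiable (by simp)
  rw [pth_eq_fderiv ((contDiff_pr hu).differentiable (by simp)),
    pr_eq_fderiv ((contDiff_pth hu).differentiable (by simp)), pr_eq_fderiv hd, pth_eq_fderiv hd]
  funext z
  have hsymm : IsSymmSndFDerivAt ℝ u z :=
    hu.contDiffAt.isSymmSndFDerivAt (by
      rw [minSmoothness_of_isRCLikeNormedField]
      exact WithTop.coe_le_coe.2 le_top)
  have happly (v w : ℝ × ℝ) :
      fderiv ℝ (fun z => fderiv ℝ u z v) z w = fderiv ℝ (fderiv ℝ u) z w v := by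
    rw [fderiv_clm_apply (hd' z) (differentiableAt_const v)]
    simp
  rw [happly, happly]
  exact hsymm _ _

theorem integrable_mul_of_hasCompactSupport {f g : ℝ × ℝ → ℝ} (hf : Continuous f)
    (hg : Continuous g) (hfs : HasCompactSupport f) : Integrable (fun z => f z * g z) :=
  (hf.mul hg).integrable_of_hasCompactSupport hfs.mul_right

theorem integral_mul_fderiv_of_hasCompactSupport {f g : ℝ × ℝ → ℝ} (hf : ContDiff ℝ ∞ f)
    (hg : ContDiff ℝ ∞ g) (hfs : HasCompactSupport f) (v : ℝ × ℝ) :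
    ∫ z, f z * fderiv ℝ g z v = -∫ z, fderiv ℝ f z v * g z :=
  integral_mul_fderiv_eq_neg_fderiv_mul_of_integrable
    (integrable_mul_of_hasCompactSupport (contDiff_fderiv_const hf v).continuous hg.continuous
      (hfs.fderiv_apply ℝ v))
    (integrable_mul_of_hasCompactSupport hf.continuous (contDiff_fderiv_const hg v).continuous hfs)
    (integrable_mul_of_hasCompactSupport hf.continuous hg.continuous hfs)
    (fun z _ => hf.differentiable (by simp) z) (fun z _ => hg.differentiable (by simp) z)

/-- Integrating by parts once in each variable exchanges the two partial derivatives. -/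
theorem integral_pth_mul_pr {f g : ℝ × ℝ → ℝ} (hf : ContDiff ℝ ∞ f) (hg : ContDiff ℝ ∞ g)
    (hfs : HasCompactSupport f) :
    ∫ z, pth f z * pr g z = ∫ z, pr f z * pth g z := by
  have hfd : Differentiable ℝ f := hf.differentiable (by simp)
  have hgd : Differentiable ℝ g := hg.differentiable (by simp)
  have hth : ∫ z, f z * pth (pr g) z = -∫ z, pth f z * pr g z := by
    rw [pth_eq_fderiv ((contDiff_pr hg).differentiable (by simp)), pth_eq_fderiv hfd]
    exact integral_mul_fderiv_of_hasCompactSupport hf (contDiff_pr hg) hfs _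
  have hr : ∫ z, f z * pr (pth g) z = -∫ z, pr f z * pth g z := by
    rw [pr_eq_fderiv ((contDiff_pth hg).differentiable (by simp)), pr_eq_fderiv hfd]
    exact integral_mul_fderiv_of_hasCompactSupport hf (contDiff_pth hg) hfs _
  rw [pth_pr_comm hg] at hth
  exact neg_injective (hth.symm.trans hr)

theorem contDiff_rpow_snd_mul {f : ℝ × ℝ → ℝ} (hf : ContDiff ℝ ∞ f)
    (hfs : ∀ z ∈ tsupport f, z.2 ≠ 0) (α : ℝ) : ContDiff ℝ ∞ (fun z => z.2 ^ α * f z) := by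
  rw [← contMDiff_iff_contDiff]
  refine contMDiff_of_tsupport fun z hz => ContDiffAt.contMDiffAt ?_
  exact (contDiffAt_snd.rpow_const_of_ne (hfs z (tsupport_mul_subset_right hz))).mul hf.contDiffAt

theorem pth_rpow_snd_mul {f : ℝ × ℝ → ℝ} (α : ℝ) (z : ℝ × ℝ) :
    pth (fun z => z.2 ^ α * f z) z = z.2 ^ α * pth f z :=
  deriv_const_mul_field (v := fun θ => f (θ, z.2)) (z.2 ^ α)

/-- Core integration-by-parts identity behind Lemma 2.6:
for α ∈ (0,1) and u ∈ C_c^∞((0,1)×(0,1)),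
∫ (∂_θθ u + ∂_r(r^α ∂_r u))² = ∫ (∂_θθ u)² + ∫ (∂_r(r^α ∂_r u))² + 2∫ r^α (∂_θr u)². -/
theorem weighted_elliptic_identity (α : ℝ) (hα : α ∈ Ioo (0:ℝ) 1)
    (u : ℝ × ℝ → ℝ) (hu : ContDiff ℝ (⊤ : ℕ∞) u) (hcs : HasCompactSupport u)
    (hsupp : tsupport u ⊆ Ioo (0:ℝ) 1 ×ˢ Ioo (0:ℝ) 1) :
    ∫ z in Ioo (0:ℝ) 1 ×ˢ Ioo (0:ℝ) 1,
        (pth (pth u) z + deriv (fun r => r ^ α * pr u (z.1, r)) z.2) ^ 2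
      = (∫ z in Ioo (0:ℝ) 1 ×ˢ Ioo (0:ℝ) 1, (pth (pth u) z) ^ 2)
        + (∫ z in Ioo (0:ℝ) 1 ×ˢ Ioo (0:ℝ) 1,
            (deriv (fun r => r ^ α * pr u (z.1, r)) z.2) ^ 2)
        + 2 * ∫ z in Ioo (0:ℝ) 1 ×ˢ Ioo (0:ℝ) 1, z.2 ^ α * (pth (pr u) z) ^ 2 := by
  have hΩ {f : ℝ × ℝ → ℝ} (hf : tsupport f ⊆ tsupport u) :
      ∀ z, z ∉ Ioo (0:ℝ) 1 ×ˢ Ioo (0:ℝ) 1 → f z = 0 := fun z hz =>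
    image_eq_zero_of_notMem_tsupport fun h => hz (hsupp (hf h))
  have hud : Differentiable ℝ u := hu.differentiable (by simp)
  have hth : ContDiff ℝ ∞ (pth u) := contDiff_pth hu
  have hths : tsupport (pth u) ⊆ tsupport u := tsupport_pth_subset hud
  have hr : ContDiff ℝ ∞ (pr u) := contDiff_pr hu
  have hrs : tsupport (pr u) ⊆ tsupport u := tsupport_pr_subset hud
  have hthr : tsupport (pth (pr u)) ⊆ tsupport u :=
    (tsupport_pth_subset (hr.differentiable (by simp))).trans hrs
  set w : ℝ × ℝ → ℝ := fun z => z.2 ^ α * pr u z with hw_def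
  have hw : ContDiff ℝ ∞ w :=
    contDiff_rpow_snd_mul hr (fun z hz => (hsupp (hrs hz)).2.1.ne') α
  have hws : tsupport w ⊆ tsupport u := tsupport_mul_subset_right.trans hrs
  set A := pth (pth u)
  have hA : Continuous A := (contDiff_pth hth).continuous
  have hAs : tsupport A ⊆ tsupport u :=
    (tsupport_pth_subset (hth.differentiable (by simp))).trans hths
  have hAc : HasCompactSupport A := hcs.of_isClosed_subset (isClosed_tsupport _) hAs
  set B := pr w
  have hB : Continuous B := (contDiff_pr hw).continuous
  have hBs : tsupport B ⊆ tsupport u :=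
    (tsupport_pr_subset (hw.differentiable (by simp))).trans hws
  have hBc : HasCompactSupport B := hcs.of_isClosed_subset (isClosed_tsupport _) hBs
  have hcross : ∫ z, A z * B z = ∫ z, z.2 ^ α * (pth (pr u) z) ^ 2 := by
    rw [integral_pth_mul_pr hth hw (hcs.of_isClosed_subset (isClosed_tsupport _) hths)]
    refine integral_congr_ae (.of_forall fun z => ?_)
    simp only [hw_def, pth_rpow_snd_mul, pth_pr_comm hu]
    ring
  change ∫ z in Ioo (0:ℝ) 1 ×ˢ Ioo (0:ℝ) 1, (A z + B z) ^ 2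
    = (∫ z in Ioo (0:ℝ) 1 ×ˢ Ioo (0:ℝ) 1, A z ^ 2)
      + (∫ z in Ioo (0:ℝ) 1 ×ˢ Ioo (0:ℝ) 1, B z ^ 2)
      + 2 * ∫ z in Ioo (0:ℝ) 1 ×ˢ Ioo (0:ℝ) 1, z.2 ^ α * (pth (pr u) z) ^ 2
  rw [setIntegral_eq_integral_of_forall_compl_eq_zero fun z hz => by simp [hΩ hAs z hz, hΩ hBs z hz],
    setIntegral_eq_integral_of_forall_compl_eq_zero fun z hz => by simp [hΩ hAs z hz],
    setIntegral_eq_integral_of_forall_compl_eq_zero fun z hz => by simp [hΩ hBs z hz],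
    setIntegral_eq_integral_of_forall_compl_eq_zero fun z hz => by simp [hΩ hthr z hz],
    ← hcross, ← integral_const_mul]
  have hAA : Integrable (fun z => A z ^ 2) := by
    simpa only [sq] using integrable_mul_of_hasCompactSupport hA hA hAc
  have hBB : Integrable (fun z => B z ^ 2) := by
    simpa only [sq] using integrable_mul_of_hasCompactSupport hB hB hBc
  rw [← integral_add hAA hBB, ← integral_add (f := fun z => A z ^ 2 + B z ^ 2) (hAA.add hBB)
    ((integrable_mul_of_hasCompactSupport hA hB hAc).const_mul 2)]
  refine integral_congr_ae (.of_forall fun z => ?_)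
  ring
end

section
/- Let α ∈ (0,1) and let Ω = (0,1)×(0,1) ⊂ ℝ² with coordinates z = (θ,r). There exists a constant C > 0, depending only on α, such that for every smooth compactly supported function u : Ω → ℝ one has ∫_Ω (∂_{θθ}u)² dθ dr + ∫_Ω r^α (∂_{θ r}u)² dθ dr + ∫_Ω r^{2+α} (∂_{rr}u)² dθ dr + ∫_Ω (∂_r(r^α ∂_r u))² dθ dr ≤ C ∫_Ω (∂_{θθ}u + ∂_r(r^α ∂_r u))² dθ dr. -/
open MeasureTheory Set

/-- Smooth functions compactly supported in the open unit square. -/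
structure IsSquareTest (f : ℝ × ℝ → ℝ) : Prop where
  smooth : ContDiff ℝ (⊤ : ℕ∞) f
  compact : HasCompactSupport f
  tsupport_subset : tsupport f ⊆ Ioo (0:ℝ) 1 ×ˢ Ioo (0:ℝ) 1

lemma pth_eq_fderiv_s6 {f : ℝ × ℝ → ℝ} {z : ℝ × ℝ} (hf : DifferentiableAt ℝ f z) :
    pth f z = fderiv ℝ f z (1, 0) := by
  have hg : HasDerivAt (fun θ : ℝ => (θ, z.2)) ((1 : ℝ), (0 : ℝ)) z.1 :=
    (hasDerivAt_id z.1).prodMk (hasDerivAt_const z.1 z.2)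
  exact (HasFDerivAt.comp_hasDerivAt z.1 (f := fun θ : ℝ => (θ, z.2)) hf.hasFDerivAt hg).deriv

lemma pr_eq_fderiv_s6 {f : ℝ × ℝ → ℝ} {z : ℝ × ℝ} (hf : DifferentiableAt ℝ f z) :
    pr f z = fderiv ℝ f z (0, 1) := by
  have hg : HasDerivAt (fun r : ℝ => (z.1, r)) ((0 : ℝ), (1 : ℝ)) z.2 :=
    (hasDerivAt_const z.2 z.1).prodMk (hasDerivAt_id z.2)
  exact (HasFDerivAt.comp_hasDerivAt z.2 (f := fun r : ℝ => (z.1, r)) hf.hasFDerivAt hg).deriv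

lemma pth_mul {f g : ℝ × ℝ → ℝ} {z : ℝ × ℝ} (hf : DifferentiableAt ℝ f z)
    (hg : DifferentiableAt ℝ g z) :
    pth (fun y => f y * g y) z = pth f z * g z + f z * pth g z := by
  rw [pth_eq_fderiv_s6 (hf.fun_mul hg), pth_eq_fderiv_s6 hf, pth_eq_fderiv_s6 hg, fderiv_fun_mul hf hg]
  simp
  ring

lemma pr_mul {f g : ℝ × ℝ → ℝ} {z : ℝ × ℝ} (hf : DifferentiableAt ℝ f z)
    (hg : DifferentiableAt ℝ g z) :
    pr (fun y => f y * g y) z = pr f z * g z + f z * pr g z := by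
  rw [pr_eq_fderiv_s6 (hf.fun_mul hg), pr_eq_fderiv_s6 hf, pr_eq_fderiv_s6 hg, fderiv_fun_mul hf hg]
  simp
  ring

namespace IsSquareTest

variable {f g : ℝ × ℝ → ℝ}

lemma differentiableAt (hf : IsSquareTest f) (z : ℝ × ℝ) : DifferentiableAt ℝ f z :=
  (hf.smooth.differentiable (by simp)) z

lemma of_tsupport_subset (hf : IsSquareTest f) (hg : ContDiff ℝ (⊤ : ℕ∞) g)
    (h : tsupport g ⊆ tsupport f) : IsSquareTest g :=
  ⟨hg, hf.compact.of_isClosed_subset (isClosed_tsupport g) h, h.trans hf.tsupport_subset⟩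

lemma fderiv_apply (hf : IsSquareTest f) (v : ℝ × ℝ) :
    IsSquareTest (fun z => fderiv ℝ f z v) :=
  hf.of_tsupport_subset ((hf.smooth.fderiv_right (by simp)).clm_apply contDiff_const)
    (tsupport_fderiv_apply_subset ℝ v)

lemma pth_eq (hf : IsSquareTest f) : pth f = fun z => fderiv ℝ f z (1, 0) :=
  funext fun z => pth_eq_fderiv_s6 (hf.differentiableAt z)

lemma pr_eq (hf : IsSquareTest f) : pr f = fun z => fderiv ℝ f z (0, 1) :=
  funext fun z => pr_eq_fderiv_s6 (hf.differentiableAt z)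

lemma pth (hf : IsSquareTest f) : IsSquareTest (pth f) := hf.pth_eq ▸ hf.fderiv_apply (1, 0)

lemma pr (hf : IsSquareTest f) : IsSquareTest (pr f) := hf.pr_eq ▸ hf.fderiv_apply (0, 1)

/-- Multiplication by a weight in `r` that is smooth for `r > 0` preserves test functions. -/
lemma weight_mul (hf : IsSquareTest f) {φ : ℝ → ℝ}
    (hφ : ∀ r, 0 < r → ContDiffAt ℝ (⊤ : ℕ∞) φ r) : IsSquareTest (fun z => φ z.2 * f z) := by
  have hs : tsupport (fun z : ℝ × ℝ => φ z.2 * f z) ⊆ tsupport f := tsupport_mul_subset_right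
  refine hf.of_tsupport_subset (contDiff_iff_contDiffAt.2 fun z => ?_) hs
  by_cases hz : z ∈ tsupport (fun z : ℝ × ℝ => φ z.2 * f z)
  · exact ((hφ z.2 (hf.tsupport_subset (hs hz)).2.1).comp z contDiffAt_snd).mul
      hf.smooth.contDiffAt
  · exact (contDiffAt_const (c := (0 : ℝ))).congr_of_eventuallyEq
      (notMem_tsupport_iff_eventuallyEq.1 hz)

lemma mul (hf : IsSquareTest f) (hg : IsSquareTest g) : IsSquareTest (fun z => f z * g z) :=
  hg.of_tsupport_subset (hf.smooth.mul hg.smooth) tsupport_mul_subset_right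

lemma add (hf : IsSquareTest f) (hg : IsSquareTest g) : IsSquareTest (fun z => f z + g z) :=
  ⟨hf.smooth.add hg.smooth, hf.compact.add hg.compact,
    (tsupport_add f g).trans (union_subset hf.tsupport_subset hg.tsupport_subset)⟩

lemma sq (hf : IsSquareTest f) : IsSquareTest (fun z => f z ^ 2) := by
  simpa only [pow_two] using hf.mul hf

lemma integrable (hf : IsSquareTest f) : Integrable f :=
  hf.smooth.continuous.integrable_of_hasCompactSupport hf.compact

lemma setIntegral_eq (hf : IsSquareTest f) :
    ∫ z in Ioo (0:ℝ) 1 ×ˢ Ioo (0:ℝ) 1, f z = ∫ z, f z :=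
  setIntegral_eq_integral_of_forall_compl_eq_zero fun _ hz =>
    image_eq_zero_of_notMem_tsupport fun h => hz (hf.tsupport_subset h)

lemma setIntegral_fderiv_apply (hf : IsSquareTest f) (v : ℝ × ℝ) :
    ∫ z in Ioo (0:ℝ) 1 ×ˢ Ioo (0:ℝ) 1, fderiv ℝ f z v = 0 := by
  rw [(hf.fderiv_apply v).setIntegral_eq]
  have h := integral_mul_fderiv_eq_neg_fderiv_mul_of_integrable (𝕜 := ℝ) (μ := volume)
    (f := f) (g := fun _ : ℝ × ℝ => (1 : ℝ)) (v := v)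
    (by simpa using (hf.fderiv_apply v).integrable) (by simp) (by simpa using hf.integrable)
    (fun z _ => hf.differentiableAt z) (fun _ _ => differentiableAt_const _)
  simpa using h.symm

lemma setIntegral_pth (hf : IsSquareTest f) :
    ∫ z in Ioo (0:ℝ) 1 ×ˢ Ioo (0:ℝ) 1, _root_.pth f z = 0 := by
  rw [hf.pth_eq]; exact hf.setIntegral_fderiv_apply _

lemma setIntegral_pr (hf : IsSquareTest f) :
    ∫ z in Ioo (0:ℝ) 1 ×ˢ Ioo (0:ℝ) 1, _root_.pr f z = 0 := by
  rw [hf.pr_eq]; exact hf.setIntegral_fderiv_apply _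

lemma pr_pth (hf : IsSquareTest f) : _root_.pr (_root_.pth f) = _root_.pth (_root_.pr f) := by
  funext z
  rw [pr_eq_fderiv_s6 (hf.pth.differentiableAt z), pth_eq_fderiv_s6 (hf.pr.differentiableAt z),
    hf.pth_eq, hf.pr_eq]
  have hd : DifferentiableAt ℝ (fderiv ℝ f) z :=
    ((hf.smooth.fderiv_right (m := (⊤ : ℕ∞)) (by simp)).differentiable (by simp)) z
  rw [fderiv_clm_apply hd (differentiableAt_const _), fderiv_clm_apply hd (differentiableAt_const _)]
  simpa using (hf.smooth.contDiffAt.isSymmSndFDerivAt (by simpa using ENat.LEInfty.out)).eq (0, 1) (1, 0)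

end IsSquareTest

lemma pth_weight_mul (φ : ℝ → ℝ) (f : ℝ × ℝ → ℝ) (z : ℝ × ℝ) :
    pth (fun y => φ y.2 * f y) z = φ z.2 * pth f z :=
  deriv_const_mul_field (φ z.2)

lemma pr_weight_mul {φ : ℝ → ℝ} {f : ℝ × ℝ → ℝ} {z : ℝ × ℝ} {φ' : ℝ}
    (hφ : HasDerivAt φ φ' z.2) (hf : DifferentiableAt ℝ f z) :
    pr (fun y => φ y.2 * f y) z = φ' * f z + φ z.2 * pr f z := by
  have hg : DifferentiableAt ℝ (fun r : ℝ => f (z.1, r)) z.2 :=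
    DifferentiableAt.comp (g := f) z.2 hf
      ((differentiableAt_const z.1).prodMk differentiableAt_id)
  exact (hφ.mul hg.hasDerivAt).deriv

/-- Stationary weighted elliptic estimate (Lemma 2.6), on C_c^∞((0,1)×(0,1)):
there is C = C(α) > 0 with
∫ (∂_θθ u)² + ∫ r^α (∂_θr u)² + ∫ r^{2+α} (∂_rr u)² + ∫ (∂_r(r^α ∂_r u))²
  ≤ C ∫ (∂_θθ u + ∂_r(r^α ∂_r u))². -/
theorem stationary_weighted_elliptic_estimate (α : ℝ) (hα : α ∈ Ioo (0:ℝ) 1) :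
    ∃ C : ℝ, 0 < C ∧
      ∀ u : ℝ × ℝ → ℝ, ContDiff ℝ (⊤ : ℕ∞) u → HasCompactSupport u →
        tsupport u ⊆ Ioo (0:ℝ) 1 ×ˢ Ioo (0:ℝ) 1 →
        (∫ z in Ioo (0:ℝ) 1 ×ˢ Ioo (0:ℝ) 1, (pth (pth u) z) ^ 2)
          + (∫ z in Ioo (0:ℝ) 1 ×ˢ Ioo (0:ℝ) 1, z.2 ^ α * (pth (pr u) z) ^ 2)
          + (∫ z in Ioo (0:ℝ) 1 ×ˢ Ioo (0:ℝ) 1, z.2 ^ (2 + α) * (pr (pr u) z) ^ 2)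
          + (∫ z in Ioo (0:ℝ) 1 ×ˢ Ioo (0:ℝ) 1,
              (deriv (fun r => r ^ α * pr u (z.1, r)) z.2) ^ 2)
        ≤ C * ∫ z in Ioo (0:ℝ) 1 ×ˢ Ioo (0:ℝ) 1,
            (pth (pth u) z + deriv (fun r => r ^ α * pr u (z.1, r)) z.2) ^ 2 := by
  refine ⟨11, by norm_num, fun u hu hc hs => ?_⟩
  have hr (p : ℝ) (r : ℝ) (h : 0 < r) : ContDiffAt ℝ (⊤ : ℕ∞) (fun x : ℝ => x ^ p) r :=
    Real.contDiffAt_rpow_const_of_ne h.ne'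
  have Tu : IsSquareTest u := ⟨hu, hc, hs⟩
  let w : ℝ × ℝ → ℝ := fun z => z.2 ^ α * pr u z
  have Tw : IsSquareTest w := Tu.pr.weight_mul (hr α)
  change _ + _ + _ + (∫ z in Ioo (0:ℝ) 1 ×ˢ Ioo (0:ℝ) 1, (pr w z) ^ 2) ≤
    11 * ∫ z in Ioo (0:ℝ) 1 ×ˢ Ioo (0:ℝ) 1, (pth (pth u) z + pr w z) ^ 2
  have T₁ := Tu.pth.pth.sq
  have T₂ := Tu.pr.pth.sq.weight_mul (hr α)
  have T₃ := Tu.pr.pr.sq.weight_mul (hr (2 + α))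
  have T₄ := Tw.pr.sq
  have T₅ := (Tu.pth.pth.add Tw.pr).sq
  have D₁ := Tu.pth.mul Tw.pr
  have D₂ := Tu.pth.mul Tw.pth
  have D₃ := (Tw.mul Tw).weight_mul (φ := fun r => r⁻¹) fun r h => contDiffAt_inv ℝ h.ne'
  have i {f : ℝ × ℝ → ℝ} (hf : IsSquareTest f) :
      IntegrableOn f (Ioo (0:ℝ) 1 ×ˢ Ioo (0:ℝ) 1) := hf.integrable.integrableOn
  have T₁₂ := T₁.add T₂
  have T₁₃ := T₁₂.add T₃
  rw [← integral_add (i T₁) (i T₂), ← integral_add (i T₁₂) (i T₃),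
    ← integral_add (i T₁₃) (i T₄)]
  have j₁ := (i D₁.pth).const_mul 22
  have j₂ := (i D₂.pr).const_mul 22
  have j₃ := (i D₃.pr).const_mul 4
  have j₅ := (i T₅).const_mul 11
  have j₅₁ : IntegrableOn (fun z => 11 * (pth (pth u) z + pr w z) ^ 2
      - 22 * pth (fun y => pth u y * pr w y) z) (Ioo (0:ℝ) 1 ×ˢ Ioo (0:ℝ) 1) := j₅.sub j₁
  have j₅₂ : IntegrableOn (fun z => 11 * (pth (pth u) z + pr w z) ^ 2
      - 22 * pth (fun y => pth u y * pr w y) z + 22 * pr (fun y => pth u y * pth w y) z)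
      (Ioo (0:ℝ) 1 ×ˢ Ioo (0:ℝ) 1) := j₅₁.add j₂
  have key : 11 * ∫ z in Ioo (0:ℝ) 1 ×ˢ Ioo (0:ℝ) 1, (pth (pth u) z + pr w z) ^ 2 =
      ∫ z in Ioo (0:ℝ) 1 ×ˢ Ioo (0:ℝ) 1, (11 * (pth (pth u) z + pr w z) ^ 2
        - 22 * pth (fun y => pth u y * pr w y) z + 22 * pr (fun y => pth u y * pth w y) z
        - 4 * pr (fun y => y.2⁻¹ * (w y * w y)) z) := by
    rw [integral_sub j₅₂ j₃, integral_add j₅₁ j₂, integral_sub j₅ j₁, integral_const_mul,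
      integral_const_mul, integral_const_mul, integral_const_mul, D₁.setIntegral_pth,
      D₂.setIntegral_pr, D₃.setIntegral_pr]
    ring
  rw [key]
  refine setIntegral_mono_on (i (T₁₃.add T₄)) (j₅₂.sub j₃)
    (measurableSet_Ioo.prod measurableSet_Ioo) fun z hz => ?_
  obtain ⟨h0, h1⟩ := hz.2
  have e₁ := pth_mul (Tu.pth.differentiableAt z) (Tw.pr.differentiableAt z)
  have e₂ := pr_mul (Tu.pth.differentiableAt z) (Tw.pth.differentiableAt z)
  have e₃ := pr_weight_mul (hasDerivAt_inv h0.ne') ((Tw.mul Tw).differentiableAt z)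
  have e₄ := pr_mul (Tw.differentiableAt z) (Tw.differentiableAt z)
  have e₅ : pth w z = z.2 ^ α * pth (pr u) z := pth_weight_mul (fun r => r ^ α) _ z
  have e₆ : pr w z = _ :=
    pr_weight_mul (Real.hasDerivAt_rpow_const (p := α) (Or.inl h0.ne')) (Tu.pr.differentiableAt z)
  have e₇ : z.2 ^ (α - 1) = z.2 ^ α / z.2 := by rw [Real.rpow_sub_one h0.ne']
  have e₈ : z.2 ^ (2 + α) = z.2 ^ 2 * z.2 ^ α := by rw [Real.rpow_add h0, Real.rpow_two]
  have hle : z.2 ^ 2 ≤ z.2 ^ α := by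
    rw [← Real.rpow_two]
    exact Real.rpow_le_rpow_of_exponent_ge h0 h1.le (by linarith [hα.2])
  have hpos : 0 < z.2 ^ α := Real.rpow_pos_of_pos h0 _
  have hwz : w z = z.2 ^ α * pr u z := rfl
  have eW : pr (fun y => y.2⁻¹ * (w y * w y)) z
      = -(w z / z.2) ^ 2 + 2 * (w z / z.2) * pr w z := by
    rw [e₃, e₄]; field_simp; ring
  have eU : z.2 ^ α * pr (pr u) z = pr w z - α * (w z / z.2) := by
    rw [e₆, e₇, hwz]; field_simp; ring
  rw [e₁, e₂, eW, Tu.pr_pth, Tw.pr_pth, e₅, e₈]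
  generalize w z / z.2 = W at *
  generalize pr w z = B at *
  have hU : z.2 ^ 2 * z.2 ^ α * pr (pr u) z ^ 2 ≤ (B - α * W) ^ 2 := by
    rw [← eU, mul_pow, sq (z.2 ^ α)]
    gcongr
  have hW : α ^ 2 * W ^ 2 ≤ W ^ 2 :=
    mul_le_of_le_one_left (sq_nonneg W) (pow_le_one₀ hα.1.le hα.2.le)
  have hθ : 0 ≤ z.2 ^ α * pth (pr u) z ^ 2 := by positivity
  nlinarith [sq_nonneg (B + α * W), sq_nonneg (W - 2 * B), sq_nonneg (pth (pth u) z)]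
end

section
/- Let δ ∈ (0,1) and let Ω_δ = (0,1)×(δ,1) ⊂ ℝ² with coordinates z = (θ,r). Then for every smooth function u on [0,1]×[δ,1] with u(θ,1) = 0 for all θ ∈ [0,1], one has ∫_{Ω_δ} u(θ,r)²/r dθ dr ≤ (4/π²)(log δ)² ∫_{Ω_δ} r (∂_r u(θ,r))² dθ dr. -/
open MeasureTheory Set

/-- The one-dimensional inequality with a subcritical constant `c`. -/
theorem sq_mul_integral_sq_div_le_of_lt {δ c : ℝ} (hδ : δ ∈ Ioo (0:ℝ) 1) (hc : 0 < c)
    (hcL : c * (-Real.log δ) < Real.pi / 2) {f f' : ℝ → ℝ}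
    (hf : ContinuousOn f (Icc δ 1)) (hf' : ContinuousOn f' (Icc δ 1))
    (hd : ∀ r ∈ Ioo δ 1, HasDerivAt f (f' r) r) (h1 : f 1 = 0) :
    c ^ 2 * ∫ r in δ..1, f r ^ 2 / r ≤ ∫ r in δ..1, r * f' r ^ 2 := by
  obtain ⟨h0, hlt⟩ := hδ
  have hpos : ∀ r ∈ Icc δ 1, 0 < r := fun r hr => h0.trans_le hr.1
  have hne : ∀ r ∈ Icc δ 1, r ≠ 0 := fun r hr => (hpos r hr).ne'
  have hcos : ∀ r ∈ Icc δ 1, 0 < Real.cos (c * (Real.log r - Real.log δ)) := by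
    intro r hr
    have hl : Real.log δ ≤ Real.log r := Real.log_le_log h0 hr.1
    have hl' : Real.log r ≤ 0 := Real.log_nonpos (hpos r hr).le hr.2
    apply Real.cos_pos_of_mem_Ioo
    constructor
    · have := mul_nonneg hc.le (sub_nonneg.2 hl)
      linarith [Real.pi_pos]
    · nlinarith
  set T : ℝ → ℝ := fun r => Real.tan (c * (Real.log r - Real.log δ)) with hT
  have hTc : ContinuousOn T (Icc δ 1) := by
    intro r hr
    have hlog : ContinuousAt (fun r => c * (Real.log r - Real.log δ)) r :=
      continuousAt_const.mul ((Real.continuousAt_log (hne r hr)).sub continuousAt_const)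
    exact (ContinuousAt.comp (f := fun r => c * (Real.log r - Real.log δ))
      (Real.continuousAt_tan.2 (hcos r hr).ne') hlog).continuousWithinAt
  have hTd : ∀ r ∈ Icc δ 1, HasDerivAt T ((1 + T r ^ 2) * (c / r)) r := by
    intro r hr
    have hlog : HasDerivAt (fun r => c * (Real.log r - Real.log δ)) (c * r⁻¹) r :=
      ((Real.hasDerivAt_log (hne r hr)).sub_const _).const_mul c
    have := (Real.hasDerivAt_tan (hcos r hr).ne').comp r hlog
    refine this.congr_deriv ?_
    rw [← Real.inv_one_add_tan_sq (hcos r hr).ne', one_div, inv_inv, div_eq_mul_inv c r]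
  set G' : ℝ → ℝ := fun r =>
    -c * (2 * f r * f' r * T r + f r ^ 2 * ((1 + T r ^ 2) * (c / r))) with hG'
  have hG'c : ContinuousOn G' (Icc δ 1) := by
    have : ContinuousOn (fun r : ℝ => c / r) (Icc δ 1) := continuousOn_const.div continuousOn_id hne
    fun_prop
  have hsq : ContinuousOn (fun r => f r ^ 2 / r) (Icc δ 1) := (hf.pow 2).div continuousOn_id hne
  have hdsq : ContinuousOn (fun r => r * f' r ^ 2) (Icc δ 1) := continuousOn_id.mul (hf'.pow 2)
  have hG'i : IntervalIntegrable G' volume δ 1 := hG'c.intervalIntegrable_of_Icc hlt.le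
  have hG : ∫ r in δ..1, G' r = 0 := by
    rw [intervalIntegral.integral_eq_sub_of_hasDerivAt_of_le
      (f := fun r => -c * (f r ^ 2 * T r)) hlt.le]
    · simp [h1, hT]
    · fun_prop
    · intro r hr
      have := (((hd r hr).pow 2).mul (hTd r (Ioo_subset_Icc_self hr))).const_mul (-c)
      refine this.congr_deriv ?_
      simp only [hG', Pi.pow_apply]
      ring
    · exact hG'i
  have key : ∫ r in δ..1, (c ^ 2 * (f r ^ 2 / r) + G' r) ≤ ∫ r in δ..1, r * f' r ^ 2 := by
    apply intervalIntegral.integral_mono_on hlt.le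
    · exact ((hsq.intervalIntegrable_of_Icc hlt.le).const_mul _).add hG'i
    · exact hdsq.intervalIntegrable_of_Icc hlt.le
    · intro r hr
      have hr0 := hne r hr
      have h : r * f' r ^ 2 - (c ^ 2 * (f r ^ 2 / r) + G' r)
          = r * (f' r + c * f r * T r / r) ^ 2 := by
        simp only [hG']
        field_simp
        ring
      have := mul_nonneg (hpos r hr).le (sq_nonneg (f' r + c * f r * T r / r))
      linarith
  rw [intervalIntegral.integral_add ((hsq.intervalIntegrable_of_Icc hlt.le).const_mul _) hG'i, hG,
    intervalIntegral.integral_const_mul] at key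
  simpa using key

/-- The one-dimensional inequality with the sharp constant. -/
theorem integral_sq_div_le {δ : ℝ} (hδ : δ ∈ Ioo (0:ℝ) 1) {f f' : ℝ → ℝ}
    (hf : ContinuousOn f (Icc δ 1)) (hf' : ContinuousOn f' (Icc δ 1))
    (hd : ∀ r ∈ Ioo δ 1, HasDerivAt f (f' r) r) (h1 : f 1 = 0) :
    ∫ r in δ..1, f r ^ 2 / r
      ≤ (4 / Real.pi ^ 2) * Real.log δ ^ 2 * ∫ r in δ..1, r * f' r ^ 2 := by
  have hL : 0 < -Real.log δ := neg_pos.2 (Real.log_neg hδ.1 hδ.2)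
  set k : ℝ := Real.pi / 2 / (-Real.log δ) with hk
  have hk0 : 0 < k := by positivity
  have hlim : k ^ 2 * ∫ r in δ..1, f r ^ 2 / r ≤ ∫ r in δ..1, r * f' r ^ 2 := by
    have ht : Filter.Tendsto (fun c : ℝ => c ^ 2 * ∫ r in δ..1, f r ^ 2 / r)
        (nhdsWithin k (Iio k)) (nhds (k ^ 2 * ∫ r in δ..1, f r ^ 2 / r)) :=
      (Continuous.tendsto (by fun_prop) k).mono_left nhdsWithin_le_nhds
    apply le_of_tendsto ht
    filter_upwards [Ioo_mem_nhdsLT hk0] with c hc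
    exact sq_mul_integral_sq_div_le_of_lt hδ hc.1 ((lt_div_iff₀ hL).1 hc.2) hf hf' hd h1
  have hlog : Real.log δ ≠ 0 := (neg_pos.1 hL).ne
  have hkc : 4 / Real.pi ^ 2 * Real.log δ ^ 2 * k ^ 2 = 1 := by
    rw [hk]
    field_simp
    norm_num
  calc ∫ r in δ..1, f r ^ 2 / r
      = 4 / Real.pi ^ 2 * Real.log δ ^ 2 * (k ^ 2 * ∫ r in δ..1, f r ^ 2 / r) := by
        rw [← mul_assoc, hkc, one_mul]
    _ ≤ _ := by gcongr

/-- Critical truncated Hardy–Poincaré inequality (Proposition 4.1, inequality part):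
for δ ∈ (0,1) and u smooth on [0,1]×[δ,1] with u(θ,1) = 0,
∫_{Ω_δ} u²/r ≤ (4/π²)(log δ)² ∫_{Ω_δ} r (∂_r u)². -/
theorem critical_truncated_hardy_poincare (δ : ℝ) (hδ : δ ∈ Ioo (0:ℝ) 1)
    (u : ℝ × ℝ → ℝ) (hu : ContDiffOn ℝ (⊤ : ℕ∞) u (Icc (0:ℝ) 1 ×ˢ Icc δ 1))
    (htop : ∀ θ ∈ Icc (0:ℝ) 1, u (θ, 1) = 0) :
    ∫ z in Ioo (0:ℝ) 1 ×ˢ Ioo δ 1, (u z) ^ 2 / z.2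
      ≤ (4 / Real.pi ^ 2) * (Real.log δ) ^ 2 *
        ∫ z in Ioo (0:ℝ) 1 ×ˢ Ioo δ 1, z.2 * (pr u z) ^ 2 := by
  have hlt := hδ.2
  set S : Set (ℝ × ℝ) := Icc (0:ℝ) 1 ×ˢ Icc δ 1
  set R : Set (ℝ × ℝ) := Ioo (0:ℝ) 1 ×ˢ Ioo δ 1 with hR
  have hRS : R ⊆ S := prod_mono Ioo_subset_Icc_self Ioo_subset_Icc_self
  have hRm : MeasurableSet R := measurableSet_Ioo.prod measurableSet_Ioo
  have hScpt : IsCompact S := isCompact_Icc.prod isCompact_Icc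
  have hSu : UniqueDiffOn ℝ S := (uniqueDiffOn_Icc one_pos).prod (uniqueDiffOn_Icc hlt)
  set v : ℝ × ℝ → ℝ := fun z => fderivWithin ℝ u S z (0, 1) with hv
  have hvc : ContinuousOn v S :=
    (hu.continuousOn_fderivWithin hSu (by simp)).clm_apply continuousOn_const
  have huc : ContinuousOn u S := hu.continuousOn
  have hline : ∀ θ : ℝ, Continuous fun r : ℝ => (θ, r) := fun θ => by fun_prop
  have hd : ∀ θ ∈ Icc (0:ℝ) 1, ∀ r ∈ Ioo δ 1,
      HasDerivAt (fun r => u (θ, r)) (v (θ, r)) r := by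
    intro θ hθ r hr
    have hfd : HasFDerivWithinAt u (fderivWithin ℝ u S (θ, r)) S (θ, r) :=
      (hu.differentiableOn (by simp) (θ, r) ⟨hθ, Ioo_subset_Icc_self hr⟩).hasFDerivWithinAt
    have hg : HasDerivWithinAt (fun r : ℝ => (θ, r)) ((0, 1) : ℝ × ℝ) (Icc δ 1) r :=
      ((hasDerivAt_const r θ).prodMk (hasDerivAt_id r)).hasDerivWithinAt
    exact (hfd.comp_hasDerivWithinAt r hg fun s hs => ⟨hθ, hs⟩).hasDerivAt
      (Icc_mem_nhds hr.1 hr.2)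
  have hpr : ∀ z ∈ R, pr u z = v z := fun z hz =>
    (hd z.1 (Ioo_subset_Icc_self hz.1) z.2 hz.2).deriv
  have hi1 : IntegrableOn (fun z : ℝ × ℝ => u z ^ 2 / z.2) R :=
    (((huc.pow 2).div continuousOn_snd fun z hz =>
      (hδ.1.trans_le hz.2.1).ne').integrableOn_compact hScpt).mono_set hRS
  have hi2 : IntegrableOn (fun z : ℝ × ℝ => z.2 * v z ^ 2) R :=
    ((continuousOn_snd.mul (hvc.pow 2)).integrableOn_compact hScpt).mono_set hRS
  have hcongr : ∫ z in R, z.2 * pr u z ^ 2 = ∫ z in R, z.2 * v z ^ 2 :=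
    setIntegral_congr_fun hRm fun z hz => by simp only [hpr z hz]
  rw [hcongr]
  rw [hR, Measure.volume_eq_prod] at hi1 hi2 ⊢
  rw [setIntegral_prod _ hi1, setIntegral_prod _ hi2, ← integral_const_mul]
  rw [IntegrableOn, ← Measure.prod_restrict] at hi1 hi2
  refine setIntegral_mono_on hi1.integral_prod_left (hi2.integral_prod_left.const_mul _)
    measurableSet_Ioo fun θ hθ => ?_
  have hθ' := Ioo_subset_Icc_self hθ
  have hmaps : MapsTo (fun r : ℝ => (θ, r)) (Icc δ 1) S := fun r hr => ⟨hθ', hr⟩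
  have := integral_sq_div_le hδ (huc.comp (hline θ).continuousOn hmaps)
    (hvc.comp (hline θ).continuousOn hmaps) (hd θ hθ') (htop θ hθ')
  simpa only [intervalIntegral.integral_of_le hlt.le, integral_Ioc_eq_integral_Ioo,
    Function.comp_apply] using this
end

section
/- Let δ ∈ (0,1) and let Ω_δ = (0,1)×(δ,1) ⊂ ℝ² with coordinates z = (θ,r). Define u(θ,r) = sin((π/2)·(log r)/(log δ)). Then u is smooth on [0,1]×[δ,1], u(θ,1) = 0 for all θ, and equality holds: ∫_{Ω_δ} u(θ,r)²/r dθ dr = (4/π²)(log δ)² ∫_{Ω_δ} r (∂_r u(θ,r))² dθ dr. In particular the constant (4/π²)(log δ)² in the critical truncated Hardy–Poincaré inequality is sharp. -/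
open MeasureTheory Set

/-- On a positive interval with `sin (a log ·) * cos (a log ·)` vanishing at both ends, the
functions `sin (a log r) ^ 2 / r` and `cos (a log r) ^ 2 / r` have the same integral. -/
theorem intervalIntegral_sin_sq_log_div_eq_cos_sq_log_div {a x y : ℝ} (ha : a ≠ 0) (hx : 0 < x)
    (hxy : x ≤ y)
    (h₀ : Real.sin (a * Real.log x) * Real.cos (a * Real.log x) = 0)
    (h₁ : Real.sin (a * Real.log y) * Real.cos (a * Real.log y) = 0) :
    ∫ r in x..y, Real.sin (a * Real.log r) ^ 2 / r =
      ∫ r in x..y, Real.cos (a * Real.log r) ^ 2 / r := by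
  have hne : ∀ r ∈ uIcc x y, r ≠ 0 := fun r hr => by
    rw [uIcc_of_le hxy] at hr
    exact (hx.trans_le hr.1).ne'
  have hlog : ContinuousOn Real.log (uIcc x y) := continuousOn_id.log hne
  have hs : IntervalIntegrable (fun r => Real.sin (a * Real.log r) ^ 2 / r) volume x y :=
    ContinuousOn.intervalIntegrable
      (((Real.continuous_sin.comp_continuousOn (hlog.const_mul a)).pow 2).div continuousOn_id hne)
  have hc : IntervalIntegrable (fun r => Real.cos (a * Real.log r) ^ 2 / r) volume x y :=
    ContinuousOn.intervalIntegrable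
      (((Real.continuous_cos.comp_continuousOn (hlog.const_mul a)).pow 2).div continuousOn_id hne)
  have key := intervalIntegral.integral_eq_sub_of_hasDerivAt
    (f := fun r => Real.sin (a * Real.log r) * Real.cos (a * Real.log r) / a)
    (f' := fun r => Real.cos (a * Real.log r) ^ 2 / r - Real.sin (a * Real.log r) ^ 2 / r)
    (fun r hr => by
      have hr0 := hne r hr
      have hl := (Real.hasDerivAt_log hr0).const_mul a
      refine ((hl.sin.mul hl.cos).div_const a).congr_deriv ?_
      field_simp
      ring) (hc.sub hs)
  rw [intervalIntegral.integral_sub hc hs, h₀, h₁] at key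
  linarith

/-- A set integral over `(0, 1) × s` of a function of the second coordinate only. -/
theorem setIntegral_Ioo_zero_one_prod_snd (g : ℝ → ℝ) (s : Set ℝ) :
    ∫ z in Ioo (0 : ℝ) 1 ×ˢ s, g z.2 = ∫ r in s, g r := by
  have h := setIntegral_prod_mul (μ := (volume : Measure ℝ)) (ν := (volume : Measure ℝ))
    (fun _ : ℝ => (1 : ℝ)) g (Ioo 0 1) s
  simpa [← Measure.volume_eq_prod] using h

/-- Sharpness of the critical truncated Hardy–Poincaré inequality
(Proposition 4.1): u(θ,r) = sin((π/2)(log r)/(log δ)) is smooth on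
[0,1]×[δ,1], vanishes at r = 1, and attains equality. -/
theorem critical_truncated_hardy_poincare_sharp (δ : ℝ) (hδ : δ ∈ Ioo (0:ℝ) 1)
    (u : ℝ × ℝ → ℝ)
    (hu : u = fun z => Real.sin ((Real.pi / 2) * (Real.log z.2 / Real.log δ))) :
    ContDiffOn ℝ (⊤ : ℕ∞) u (Icc (0:ℝ) 1 ×ˢ Icc δ 1) ∧
    (∀ θ : ℝ, u (θ, 1) = 0) ∧
    ∫ z in Ioo (0:ℝ) 1 ×ˢ Ioo δ 1, (u z) ^ 2 / z.2
      = (4 / Real.pi ^ 2) * (Real.log δ) ^ 2 *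
        ∫ z in Ioo (0:ℝ) 1 ×ˢ Ioo δ 1, z.2 * (pr u z) ^ 2 := by
  have hL : Real.log δ ≠ 0 := (Real.log_neg hδ.1 hδ.2).ne
  set a : ℝ := Real.pi / 2 / Real.log δ with ha_def
  have ha : a ≠ 0 := div_ne_zero (by positivity) hL
  have hu' : u = fun z => Real.sin (a * Real.log z.2) := by
    rw [hu]
    ext z
    congr 1
    rw [ha_def]
    ring
  refine ⟨?_, fun θ => by simp [hu], ?_⟩
  · rw [hu']
    exact Real.contDiff_sin.comp_contDiffOn
      (contDiffOn_const.mul (contDiffOn_snd.log fun z hz => (hδ.1.trans_le hz.2.1).ne'))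
  · have hpr : ∀ z ∈ Ioo (0:ℝ) 1 ×ˢ Ioo δ 1,
        z.2 * pr u z ^ 2 = a ^ 2 * (Real.cos (a * Real.log z.2) ^ 2 / z.2) := by
      intro z hz
      have hz0 : z.2 ≠ 0 := (hδ.1.trans hz.2.1).ne'
      have hd : pr u z = Real.cos (a * Real.log z.2) * (a * z.2⁻¹) := by
        rw [pr, hu']
        exact ((Real.hasDerivAt_log hz0).const_mul a).sin.deriv
      rw [hd]
      field_simp
    have hδa : a * Real.log δ = Real.pi / 2 := div_mul_cancel₀ _ hL
    have key := intervalIntegral_sin_sq_log_div_eq_cos_sq_log_div ha hδ.1 hδ.2.le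
      (by simp [hδa]) (by simp)
    rw [intervalIntegral.integral_of_le hδ.2.le, intervalIntegral.integral_of_le hδ.2.le,
      integral_Ioc_eq_integral_Ioo, integral_Ioc_eq_integral_Ioo] at key
    rw [setIntegral_congr_fun (measurableSet_Ioo.prod measurableSet_Ioo) hpr, integral_const_mul,
      setIntegral_Ioo_zero_one_prod_snd (fun r => Real.cos (a * Real.log r) ^ 2 / r), ← key, hu',
      setIntegral_Ioo_zero_one_prod_snd (fun r => Real.sin (a * Real.log r) ^ 2 / r), ← mul_assoc]
    have hconst : 4 / Real.pi ^ 2 * Real.log δ ^ 2 * a ^ 2 = 1 := by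
      rw [ha_def]
      field_simp
      norm_num
    rw [hconst, one_mul]
end

section
/- Let δ ∈ (0,1) and let Ω_δ = (0,1)×(δ,1) ⊂ ℝ² with coordinates z = (θ,r). Then for every smooth compactly supported function u : Ω_δ → ℝ one has ∫_{Ω_δ} u(θ,r)²/r dθ dr ≤ (1/π²)(log δ)² ∫_{Ω_δ} r (∂_r u(θ,r))² dθ dr. -/
open MeasureTheory Set

/-- The function `sin (k log (r / δ))`, `k = π / |log δ|`, is positive on `(δ, 1)`. -/
lemma sin_log_pos {δ r : ℝ} (hδ : 0 < δ) (hr : r ∈ Ioo δ 1) :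
    0 < Real.sin (Real.pi / (-Real.log δ) * (Real.log r - Real.log δ)) := by
  have hr0 : 0 < r := hδ.trans hr.1
  have h1 : Real.log δ < Real.log r := Real.log_lt_log hδ hr.1
  have h2 : Real.log r < 0 := Real.log_neg hr0 hr.2
  have hL : 0 < -Real.log δ := by linarith
  apply Real.sin_pos_of_pos_of_lt_pi
  · exact mul_pos (div_pos Real.pi_pos hL) (by linarith)
  · rw [div_mul_eq_mul_div, div_lt_iff₀ hL]
    exact mul_lt_mul_of_pos_left (by linarith) Real.pi_pos

/-- One-dimensional critical Hardy–Poincaré inequality on a subinterval of `(δ, 1)`. -/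
lemma integral_sq_div_le_integral_mul_deriv_sq {δ a b : ℝ} (hδ : 0 < δ) (ha : δ < a)
    (hab : a ≤ b) (hb : b < 1) {v v' : ℝ → ℝ} (hv : ∀ r, HasDerivAt v (v' r) r)
    (hv' : Continuous v') (hva : v a = 0) (hvb : v b = 0) :
    ∫ r in a..b, v r ^ 2 / r
      ≤ 1 / Real.pi ^ 2 * Real.log δ ^ 2 * ∫ r in a..b, r * v' r ^ 2 := by
  set k := Real.pi / (-Real.log δ) with hk
  have hlog : Real.log δ < 0 := Real.log_neg hδ (by linarith)
  have hk0 : 0 < k := div_pos Real.pi_pos (by linarith)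
  have hvc : Continuous v := continuous_iff_continuousAt.2 fun r => (hv r).continuousAt
  let s : ℝ → ℝ := fun r => Real.sin (k * (Real.log r - Real.log δ))
  let c : ℝ → ℝ := fun r => Real.cos (k * (Real.log r - Real.log δ))
  let G : ℝ → ℝ := fun r =>
    2 * k * (c r / s r) * v r * v' r - k ^ 2 * (1 + (c r / s r) ^ 2) * v r ^ 2 / r
  have hpos : ∀ r ∈ uIcc a b, 0 < r ∧ 0 < s r := by
    intro r hr
    rw [uIcc_of_le hab] at hr
    have h1 : δ < r := ha.trans_le hr.1
    exact ⟨hδ.trans h1, sin_log_pos hδ ⟨h1, hr.2.trans_lt hb⟩⟩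
  have hlogc : ContinuousOn (fun r => k * (Real.log r - Real.log δ)) (uIcc a b) :=
    continuousOn_const.mul ((Real.continuousOn_log.mono fun r hr => (hpos r hr).1.ne').sub
      continuousOn_const)
  have hsc : ContinuousOn s (uIcc a b) := Real.continuous_sin.comp_continuousOn hlogc
  have hcc : ContinuousOn c (uIcc a b) := Real.continuous_cos.comp_continuousOn hlogc
  have hq : ContinuousOn (fun r => c r / s r) (uIcc a b) :=
    hcc.div hsc fun r hr => (hpos r hr).2.ne'
  have hGc : ContinuousOn G (uIcc a b) := by
    refine (((continuousOn_const.mul hq).mul hvc.continuousOn).mul hv'.continuousOn).sub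
      (ContinuousOn.div ?_ continuousOn_id fun r hr => (hpos r hr).1.ne')
    exact (continuousOn_const.mul (continuousOn_const.add (hq.pow 2))).mul
      (hvc.pow 2).continuousOn
  have hG : ∫ r in a..b, G r = 0 := by
    have hderiv : ∀ r ∈ uIcc a b, HasDerivAt (fun r => k * (c r / s r) * v r ^ 2) (G r) r := by
      intro r hr
      obtain ⟨hr0, hs0⟩ := hpos r hr
      have hl : HasDerivAt (fun r => k * (Real.log r - Real.log δ)) (k * r⁻¹) r :=
        ((Real.hasDerivAt_log hr0.ne').sub_const _).const_mul k
      have hs : HasDerivAt s (c r * (k * r⁻¹)) r := hl.sin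
      have hc : HasDerivAt c (-s r * (k * r⁻¹)) r := hl.cos
      refine (((hc.div hs hs0.ne').const_mul k).mul ((hv r).pow 2)).congr_deriv ?_
      simp only [G, Pi.div_apply, Pi.pow_apply]
      field_simp
      ring
    rw [intervalIntegral.integral_eq_sub_of_hasDerivAt hderiv hGc.intervalIntegrable]
    simp [hva, hvb]
  have hi1 : IntervalIntegrable (fun r => v r ^ 2 / r) volume a b :=
    ContinuousOn.intervalIntegrable
      ((hvc.pow 2).continuousOn.div continuousOn_id fun r hr => (hpos r hr).1.ne')
  have hi2 : IntervalIntegrable (fun r => r * v' r ^ 2) volume a b :=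
    (continuous_id.mul (hv'.pow 2)).intervalIntegrable _ _
  have hmono : ∫ r in a..b, G r ≤ ∫ r in a..b, (r * v' r ^ 2 - k ^ 2 * (v r ^ 2 / r)) := by
    refine intervalIntegral.integral_mono_on hab hGc.intervalIntegrable
      (hi2.sub (hi1.const_mul _)) fun r hr => ?_
    obtain ⟨hr0, hs0⟩ := hpos r (by rwa [uIcc_of_le hab])
    have h : 0 ≤ r * (v' r - k * (c r / s r) * v r / r) ^ 2 := by positivity
    have e : r * (v' r - k * (c r / s r) * v r / r) ^ 2
        = r * v' r ^ 2 - k ^ 2 * (v r ^ 2 / r) - G r := by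
      simp only [G]
      generalize c r / s r = q
      field_simp
      ring
    linarith
  rw [hG, intervalIntegral.integral_sub hi2 (hi1.const_mul _),
    intervalIntegral.integral_const_mul] at hmono
  have e : 1 / Real.pi ^ 2 * Real.log δ ^ 2 = (k ^ 2)⁻¹ := by
    rw [hk, div_pow, neg_sq, inv_div]; ring
  rw [e, inv_mul_eq_div, le_div_iff₀ (by positivity)]
  linarith

lemma exists_Icc_of_isCompact_subset_Ioo {K : Set ℝ} (hK : IsCompact K) {c d : ℝ} (hcd : c < d)
    (h : K ⊆ Ioo c d) : ∃ a b, c < a ∧ a ≤ b ∧ b < d ∧ K ⊆ Ioo a b := by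
  rcases K.eq_empty_or_nonempty with rfl | hne
  · obtain ⟨m, hm⟩ := exists_between hcd
    exact ⟨m, m, hm.1, le_rfl, hm.2, empty_subset _⟩
  · obtain ⟨x, hx, hx'⟩ := hK.exists_isLeast hne
    obtain ⟨y, hy, hy'⟩ := hK.exists_isGreatest hne
    obtain ⟨a, ha⟩ := exists_between (h hx).1
    obtain ⟨b, hb⟩ := exists_between (h hy).2
    exact ⟨a, b, ha.1, (ha.2.trans_le ((hx' hy).trans hb.1.le)).le, hb.2,
      fun z hz => ⟨ha.2.trans_le (hx' hz), (hy' hz).trans_lt hb.1⟩⟩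

/-- Critical truncated Hardy–Poincaré inequality in the Dirichlet space
(Proposition 4.4, inequality part): for δ ∈ (0,1) and u ∈ C_c^∞((0,1)×(δ,1)),
∫_{Ω_δ} u²/r ≤ (1/π²)(log δ)² ∫_{Ω_δ} r (∂_r u)². -/
theorem critical_truncated_hardy_poincare_dirichlet (δ : ℝ) (hδ : δ ∈ Ioo (0:ℝ) 1)
    (u : ℝ × ℝ → ℝ) (hu : ContDiff ℝ (⊤ : ℕ∞) u) (hcs : HasCompactSupport u)
    (hsupp : tsupport u ⊆ Ioo (0:ℝ) 1 ×ˢ Ioo δ 1) :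
    ∫ z in Ioo (0:ℝ) 1 ×ˢ Ioo δ 1, (u z) ^ 2 / z.2
      ≤ (1 / Real.pi ^ 2) * (Real.log δ) ^ 2 *
        ∫ z in Ioo (0:ℝ) 1 ×ˢ Ioo δ 1, z.2 * (pr u z) ^ 2 := by
  obtain ⟨hδ0, hδ1⟩ := hδ
  obtain ⟨a, b, ha, hab, hb, hK⟩ := exists_Icc_of_isCompact_subset_Ioo
    (hcs.isCompact.image continuous_snd) hδ1 (by
      rintro _ ⟨z, hz, rfl⟩
      exact (hsupp hz).2)
  have hzero : ∀ θ r, r ∉ Ioo a b → u (θ, r) = 0 := fun θ r hr =>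
    image_eq_zero_of_notMem_tsupport fun hz => hr (hK ⟨_, hz, rfl⟩)
  have hslice : ∀ z : ℝ × ℝ,
      HasDerivAt (fun r => u (z.1, r)) (fderiv ℝ u z (0, 1)) z.2 := fun z =>
    HasFDerivAt.comp_hasDerivAt z.2
      ((hu.differentiable (by simp)) z).hasFDerivAt
      ((hasDerivAt_const z.2 z.1).prodMk (hasDerivAt_id z.2))
  have hpr : pr u = fun z => fderiv ℝ u z (0, 1) := funext fun z => (hslice z).deriv
  have hprc : Continuous (pr u) := by
    rw [hpr]
    exact (hu.continuous_fderiv (by simp)).clm_apply continuous_const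
  have hsub : Ioo (0:ℝ) 1 ×ˢ Ioo δ 1 ⊆ Icc (0:ℝ) 1 ×ˢ Icc δ 1 :=
    prod_mono Ioo_subset_Icc_self Ioo_subset_Icc_self
  have hcpt : IsCompact (Icc (0:ℝ) 1 ×ˢ Icc δ 1) := isCompact_Icc.prod isCompact_Icc
  have hi1 : IntegrableOn (fun z : ℝ × ℝ => u z ^ 2 / z.2) (Ioo (0:ℝ) 1 ×ˢ Ioo δ 1)
      (volume.prod volume) :=
    (ContinuousOn.integrableOn_compact hcpt ((hu.continuous.pow 2).continuousOn.div
      continuous_snd.continuousOn fun z hz => (hδ0.trans_le hz.2.1).ne')).mono_set hsub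
  have hi2 : IntegrableOn (fun z : ℝ × ℝ => z.2 * pr u z ^ 2) (Ioo (0:ℝ) 1 ×ˢ Ioo δ 1)
      (volume.prod volume) :=
    (ContinuousOn.integrableOn_compact hcpt
      (continuous_snd.mul (hprc.pow 2)).continuousOn).mono_set hsub
  have hIoc : Ioc a b ⊆ Ioo δ 1 := fun r hr => ⟨ha.trans hr.1, hr.2.trans_lt hb⟩
  rw [Measure.volume_eq_prod, setIntegral_prod _ hi1, setIntegral_prod _ hi2,
    ← integral_const_mul]
  rw [IntegrableOn, ← Measure.prod_restrict] at hi1 hi2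
  refine integral_mono hi1.integral_prod_left (hi2.integral_prod_left.const_mul _) fun θ => ?_
  have hcθ : Continuous fun r => pr u (θ, r) := hprc.comp (by fun_prop)
  calc ∫ r in Ioo δ 1, u (θ, r) ^ 2 / r
      = ∫ r in Ioc a b, u (θ, r) ^ 2 / r := by
        refine setIntegral_eq_of_subset_of_forall_sdiff_eq_zero measurableSet_Ioo hIoc
          fun r hr => ?_
        simp [hzero θ r fun h => hr.2 (Ioo_subset_Ioc_self h)]
    _ ≤ 1 / Real.pi ^ 2 * Real.log δ ^ 2 * ∫ r in Ioc a b, r * pr u (θ, r) ^ 2 := by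
        rw [← intervalIntegral.integral_of_le hab, ← intervalIntegral.integral_of_le hab]
        exact integral_sq_div_le_integral_mul_deriv_sq hδ0 ha hab hb
          (v := fun r => u (θ, r)) (v' := fun r => pr u (θ, r))
          (fun r => by rw [hpr]; exact hslice (θ, r)) hcθ
          (hzero θ a (by simp)) (hzero θ b (by simp))
    _ ≤ 1 / Real.pi ^ 2 * Real.log δ ^ 2 * ∫ r in Ioo δ 1, r * pr u (θ, r) ^ 2 := by
        refine mul_le_mul_of_nonneg_left (setIntegral_mono_set ?_ ?_ hIoc.eventuallyLE)
          (by positivity)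
        · exact ((continuous_id.mul (hcθ.pow 2)).integrableOn_Icc).mono_set Ioo_subset_Icc_self
        · filter_upwards [ae_restrict_mem measurableSet_Ioo] with r hr
          exact mul_nonneg (hδ0.trans hr.1).le (sq_nonneg _)
end

section
/- Let δ ∈ (0,1) and let Ω_δ = (0,1)×(δ,1) ⊂ ℝ² with coordinates z = (θ,r). Define u(θ,r) = sin(πθ)·sin(π·(log r)/(log δ)). Then u vanishes on the boundary of Ω_δ and equality holds: ∫_{Ω_δ} u(θ,r)²/r dθ dr = (1/π²)(log δ)² ∫_{Ω_δ} r (∂_r u(θ,r))² dθ dr. -/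
open MeasureTheory Set

/-- The phase `π (log r) / L` has derivative `π / (r L)`. -/
theorem hasDerivAt_pi_mul_log_div (L : ℝ) {r : ℝ} (hr : r ≠ 0) :
    HasDerivAt (fun r => Real.pi * (Real.log r / L)) (Real.pi * (r⁻¹ / L)) r :=
  ((Real.hasDerivAt_log hr).div_const L).const_mul Real.pi

theorem integral_sin_sq_log_div_eq_integral_cos_sq {δ : ℝ} (hδ : δ ∈ Ioo (0 : ℝ) 1) :
    ∫ r in δ..1, Real.sin (Real.pi * (Real.log r / Real.log δ)) ^ 2 / r
      = ∫ r in δ..1, Real.cos (Real.pi * (Real.log r / Real.log δ)) ^ 2 / r := by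
  have hL : Real.log δ ≠ 0 := (Real.log_neg hδ.1 hδ.2).ne
  have hne : ∀ r ∈ uIcc δ 1, r ≠ 0 := fun r hr => by
    rw [uIcc_of_le hδ.2.le] at hr
    exact (hδ.1.trans_le hr.1).ne'
  have hlog : ContinuousOn (fun r => Real.pi * (Real.log r / Real.log δ)) (uIcc δ 1) :=
    fun r hr => (hasDerivAt_pi_mul_log_div _ (hne r hr)).continuousAt.continuousWithinAt
  have hs : IntervalIntegrable
      (fun r => Real.sin (Real.pi * (Real.log r / Real.log δ)) ^ 2 / r) volume δ 1 :=
    ((Real.continuous_sin.comp_continuousOn hlog |>.pow 2).div continuousOn_id hne).intervalIntegrable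
  have hc : IntervalIntegrable
      (fun r => Real.cos (Real.pi * (Real.log r / Real.log δ)) ^ 2 / r) volume δ 1 :=
    ((Real.continuous_cos.comp_continuousOn hlog |>.pow 2).div continuousOn_id hne).intervalIntegrable
  have hF := intervalIntegral.integral_eq_sub_of_hasDerivAt
    (f := fun r => Real.log δ / Real.pi * (Real.sin (Real.pi * (Real.log r / Real.log δ)) *
      Real.cos (Real.pi * (Real.log r / Real.log δ))))
    (f' := fun r => Real.cos (Real.pi * (Real.log r / Real.log δ)) ^ 2 / r -
      Real.sin (Real.pi * (Real.log r / Real.log δ)) ^ 2 / r)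
    (fun r hr => by
      have h := hasDerivAt_pi_mul_log_div (Real.log δ) (hne r hr)
      refine ((h.sin.mul h.cos).const_mul (Real.log δ / Real.pi)).congr_deriv ?_
      have := hne r hr
      field_simp
      ring)
    (hc.sub hs)
  rw [intervalIntegral.integral_sub hc hs] at hF
  simp only [Real.log_one, zero_div, mul_zero, Real.sin_zero, zero_mul, div_self hL, mul_one,
    Real.sin_pi, sub_self] at hF
  linarith

/-- Sharpness of the Dirichlet critical truncated Hardy–Poincaré inequality
(Proposition 4.4): u(θ,r) = sin(πθ)·sin(π(log r)/(log δ)) vanishes on the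
boundary of Ω_δ = (0,1)×(δ,1) and attains equality. -/
theorem critical_truncated_hardy_poincare_dirichlet_sharp (δ : ℝ) (hδ : δ ∈ Ioo (0:ℝ) 1)
    (u : ℝ × ℝ → ℝ)
    (hu : u = fun z =>
      Real.sin (Real.pi * z.1) * Real.sin (Real.pi * (Real.log z.2 / Real.log δ))) :
    (∀ z ∈ frontier (Ioo (0:ℝ) 1 ×ˢ Ioo δ 1), u z = 0) ∧
    ∫ z in Ioo (0:ℝ) 1 ×ˢ Ioo δ 1, (u z) ^ 2 / z.2
      = (1 / Real.pi ^ 2) * (Real.log δ) ^ 2 *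
        ∫ z in Ioo (0:ℝ) 1 ×ˢ Ioo δ 1, z.2 * (pr u z) ^ 2 := by
  have hL : Real.log δ ≠ 0 := (Real.log_neg hδ.1 hδ.2).ne
  constructor
  · rintro ⟨θ, r⟩ hz
    rw [frontier_prod_eq, frontier_Ioo hδ.2, frontier_Ioo zero_lt_one] at hz
    subst hu
    rcases hz with ⟨-, rfl | rfl⟩ | ⟨rfl | rfl, -⟩ <;> simp [hL]
  · have hprod : ∀ g : ℝ → ℝ,
        ∫ z in Ioo (0:ℝ) 1 ×ˢ Ioo δ 1, Real.sin (Real.pi * z.1) ^ 2 * g z.2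
          = (∫ θ in Ioo (0:ℝ) 1, Real.sin (Real.pi * θ) ^ 2) * ∫ r in δ..1, g r := fun g => by
      rw [intervalIntegral.integral_of_le hδ.2.le, integral_Ioc_eq_integral_Ioo]
      exact setIntegral_prod_mul (fun θ => Real.sin (Real.pi * θ) ^ 2) g _ _
    have hmeas : MeasurableSet (Ioo (0:ℝ) 1 ×ˢ Ioo δ 1) := measurableSet_Ioo.prod measurableSet_Ioo
    rw [← integral_const_mul]
    calc _ = (∫ θ in Ioo (0:ℝ) 1, Real.sin (Real.pi * θ) ^ 2) *
            ∫ r in δ..1, Real.sin (Real.pi * (Real.log r / Real.log δ)) ^ 2 / r := by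
          rw [← hprod]
          congr 1 with z
          simp only [hu]
          ring
      _ = _ := by
          rw [integral_sin_sq_log_div_eq_integral_cos_sq hδ, ← hprod]
          refine setIntegral_congr_fun hmeas fun z hz => ?_
          have hr : z.2 ≠ 0 := (hδ.1.trans hz.2.1).ne'
          have hpr : pr u z = Real.sin (Real.pi * z.1) *
              (Real.cos (Real.pi * (Real.log z.2 / Real.log δ)) *
                (Real.pi * (z.2⁻¹ / Real.log δ))) := by
            simp only [pr, hu]
            exact ((hasDerivAt_pi_mul_log_div (Real.log δ) hr).sin.const_mul
              (Real.sin (Real.pi * z.1))).deriv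
          simp only [hpr]
          field_simp
end
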